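/- If there exist both a surjective R-linear map from M onto N and an injective R-linear map from M into N, then n(i) = ℓ(i) for every i ∈ ι, and consequently M and N are isomorphic as R-modules. -/

import Mathlib

open DirectSum

theorem LinearMap.eq_zero_of_isEmpty_linearEquiv {R A B : Type*} [Ring R]
    [AddCommGroup A] [Module R A] [AddCommGroup B] [Module R B]
    [IsSimpleModule R A] [IsSimpleModule R B] (h : IsEmpty (A ≃ₗ[R] B)) (f : A →ₗ[R] B) :
    f = 0 :=
  f.bijective_or_eq_zero.resolve_left fun hf => h.elim (.ofBijective f hf)

theorem LinearMap.pi_eq_zero_of_isEmpty_linearEquiv {R A B α β : Type*} [Ring R] [Finite α]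
    [AddCommGroup A] [Module R A] [AddCommGroup B] [Module R B]
    [IsSimpleModule R A] [IsSimpleModule R B] (h : IsEmpty (A ≃ₗ[R] B))
    (f : (α → A) →ₗ[R] (β → B)) : f = 0 := by
  classical
  refine LinearMap.pi_ext' fun a => LinearMap.ext fun x => funext fun b => ?_
  exact LinearMap.congr_fun
    (eq_zero_of_isEmpty_linearEquiv h (proj b ∘ₗ f ∘ₗ single R (fun _ => A) a)) x

section DiagonalBlocks

variable {R ι : Type*} [Ring R] [DecidableEq ι] {M N : ι → Type*}
  [∀ i, AddCommGroup (M i)] [∀ i, Module R (M i)]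
  [∀ i, AddCommGroup (N i)] [∀ i, Module R (N i)]

/-- The `i`-th diagonal block of a linear map between direct sums. -/
def DirectSum.diagonalBlock (f : (⨁ i, M i) →ₗ[R] ⨁ i, N i) (i : ι) : M i →ₗ[R] N i :=
  component R ι N i ∘ₗ f ∘ₗ lof R ι M i

variable {f : (⨁ i, M i) →ₗ[R] ⨁ i, N i}

theorem DirectSum.apply_eq_diagonalBlock_apply
    (h : ∀ i j, i ≠ j → component R ι N j ∘ₗ f ∘ₗ lof R ι M i = 0) (i : ι) (x : ⨁ i, M i) :
    f x i = diagonalBlock f i (x i) := by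
  suffices component R ι N i ∘ₗ f = diagonalBlock f i ∘ₗ component R ι M i from
    LinearMap.congr_fun this x
  refine linearMap_ext R fun j => ?_
  obtain rfl | hij := eq_or_ne j i
  · ext y
    simp [diagonalBlock, component.lof_self]
  · rw [LinearMap.comp_assoc, h j i hij]
    ext y
    simp [component.of, hij]

theorem DirectSum.diagonalBlock_surjective
    (h : ∀ i j, i ≠ j → component R ι N j ∘ₗ f ∘ₗ lof R ι M i = 0)
    (hf : Function.Surjective f) (i : ι) : Function.Surjective (diagonalBlock f i) := fun y => by
  obtain ⟨x, hx⟩ := hf (lof R ι N i y)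
  exact ⟨x i, by rw [← apply_eq_diagonalBlock_apply h, hx, lof_apply]⟩

theorem DirectSum.diagonalBlock_injective
    (h : ∀ i j, i ≠ j → component R ι N j ∘ₗ f ∘ₗ lof R ι M i = 0)
    (hf : Function.Injective f) (i : ι) : Function.Injective (diagonalBlock f i) := by
  refine (injective_iff_map_eq_zero _).2 fun x hx => ?_
  suffices lof R ι M i x = 0 by rw [← lof_apply R i x, this, zero_apply]
  refine (injective_iff_map_eq_zero f).1 hf _ (DFinsupp.ext fun j => ?_)
  obtain rfl | hij := eq_or_ne i j
  · exact hx
  · exact LinearMap.congr_fun (h i j hij) x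

end DiagonalBlocks

theorem Module.length_fin_fun_of_isSimpleModule (R A : Type*) [Ring R] [AddCommGroup A]
    [Module R A] [IsSimpleModule R A] (k : ℕ) : Module.length R (Fin k → A) = k := by
  simp

/-- Let `R` be a ring and `(S i)_{i ∈ ι}` a family of pairwise non-isomorphic
simple `R`-modules.  Let `M = ⨁_i (S i)^{⊕ n i}` and `N = ⨁_i (S i)^{⊕ ℓ i}`.  If there exist
both a surjective `R`-linear map from `M` onto `N` and an injective `R`-linear map from `M`
into `N`, then `n i = ℓ i` for every `i`, and consequently `M ≅ N` as `R`-modules. -/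
theorem multiplicity_eq_of_surjective_and_injective
    {R : Type*} [Ring R] {ι : Type*} (S : ι → Type*)
    [∀ i, AddCommGroup (S i)] [∀ i, Module R (S i)]
    (hsimple : ∀ i, IsSimpleModule R (S i))
    (hpairwise : ∀ i j, i ≠ j → IsEmpty (S i ≃ₗ[R] S j))
    (n ℓ : ι → ℕ)
    (f : (⨁ i, (Fin (n i) → S i)) →ₗ[R] ⨁ i, (Fin (ℓ i) → S i))
    (hf : Function.Surjective f)
    (g : (⨁ i, (Fin (n i) → S i)) →ₗ[R] ⨁ i, (Fin (ℓ i) → S i))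
    (hg : Function.Injective g) :
    (∀ i, n i = ℓ i) ∧
      Nonempty ((⨁ i, (Fin (n i) → S i)) ≃ₗ[R] ⨁ i, (Fin (ℓ i) → S i)) := by
  classical
  have hoff (φ : (⨁ i, (Fin (n i) → S i)) →ₗ[R] ⨁ i, (Fin (ℓ i) → S i)) (i j : ι) (hij : i ≠ j) :
      component R ι _ j ∘ₗ φ ∘ₗ lof R ι _ i = 0 :=
    LinearMap.pi_eq_zero_of_isEmpty_linearEquiv (hpairwise i j hij) _
  have hmult (i : ι) : n i = ℓ i := by
    have hle := Module.length_le_of_injective _ (diagonalBlock_injective (hoff g) hg i)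
    have hge := Module.length_le_of_surjective _ (diagonalBlock_surjective (hoff f) hf i)
    rw [Module.length_fin_fun_of_isSimpleModule, Module.length_fin_fun_of_isSimpleModule] at hle hge
    exact le_antisymm (mod_cast hle) (mod_cast hge)
  obtain rfl : n = ℓ := funext hmult
  exact ⟨hmult, ⟨.refl R _⟩⟩
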